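/- For every s ∈ ℂ with Re(s) > −1, the Laplace transform of F satisfies ∫_0^∞ e^{−sx} F(x) dx = ∏_{j≥0} 1/(1 + 2^{−j} s), where the infinite product converges. -/

import Mathlib

open Filter Real

/-- `Q j = ∏_{ℓ=1}^{j} (1 - 2^{-ℓ})`. -/
noncomputable def Q (j : ℕ) : ℝ := ∏ l ∈ Finset.range j, (1 - (2:ℝ)^(-(l:ℤ)-1))

/-- `Q_∞ = ∏_{ℓ≥1} (1 - 2^{-ℓ})`. -/
noncomputable def Qinf : ℝ := ∏' l : ℕ, (1 - (2:ℝ)^(-(l:ℤ)-1))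

/-- `F(x) = ∑_{j≥0} (-1)^j 2^{-j(j-1)/2} e^{-2^j x} / (Q_j Q_∞)`. -/
noncomputable def F (x : ℝ) : ℝ :=
  ∑' j : ℕ, (-1:ℝ)^j * ((2:ℝ)^(j.choose 2))⁻¹ * Real.exp (-(2:ℝ)^j * x) / (Q j * Qinf)


lemma lt_zpow_eq (l : ℕ) : (2:ℝ)^(-(l:ℤ)-1) = ((2:ℝ)^(l+1))⁻¹ := by
  rw [show (-(l:ℤ)-1) = -((l+1:ℕ):ℤ) by push_cast; ring, zpow_neg, zpow_natCast]

lemma Q_succ (j : ℕ) : Q (j+1) = Q j * (1 - ((2:ℝ)^(j+1))⁻¹) := by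
  unfold Q
  rw [Finset.prod_range_succ, lt_zpow_eq]

lemma Q_zero : Q 0 = 1 := by simp [Q]

lemma Q_lower_aux (j : ℕ) : 1/4 + ((2:ℝ)^(j+2))⁻¹ ≤ Q (j+1) := by
  induction j with
  | zero => rw [Q_succ, Q_zero]; norm_num
  | succ j ih =>
    rw [Q_succ (j+1)]
    have h1 : ((2:ℝ)^(j+2))⁻¹ ≤ 1/4 := by
      have : (1:ℝ) ≤ 2^j := one_le_pow₀ (by norm_num)
      rw [inv_le_comm₀ (by positivity) (by norm_num), pow_add]
      norm_num; linarith
    have h0 : 0 < ((2:ℝ)^(j+2))⁻¹ := by positivity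
    have h2 : ((2:ℝ)^(j+1+2))⁻¹ = ((2:ℝ)^(j+2))⁻¹ / 2 := by
      rw [show j+1+2 = (j+2)+1 by ring, pow_succ _ (j+2), mul_inv]; rfl
    rw [h2, show j+1+1 = j+2 by ring]
    nlinarith

lemma Q_lower (j : ℕ) : 1/4 ≤ Q j := by
  cases j with
  | zero => rw [Q_zero]; norm_num
  | succ j =>
    have := Q_lower_aux j
    have h0 : 0 < ((2:ℝ)^(j+2))⁻¹ := by positivity
    linarith

lemma Q_tendsto : Tendsto Q atTop (nhds Qinf) := by
  have h : Multipliable (fun l : ℕ => 1 - (2:ℝ)^(-(l:ℤ)-1)) := by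
    have := multipliable_one_add_of_summable (f := fun l : ℕ => -(2:ℝ)^(-(l:ℤ)-1)) (by
      simp only [lt_zpow_eq, norm_neg, norm_inv, norm_pow, Real.norm_ofNat]
      have := (summable_nat_add_iff 1).2 summable_geometric_two
      simpa using this)
    simpa [sub_eq_add_neg] using this
  exact h.tendsto_prod_tprod_nat

lemma Qinf_lower : 1/4 ≤ Qinf := ge_of_tendsto' Q_tendsto Q_lower

lemma prod_low (k : ℕ) :
    ∏ j ∈ Finset.range k, (1 - (2:ℝ)^k / 2^j) = (-1)^k * 2^((k+1).choose 2) * Q k := by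
  induction k with
  | zero => simp [Q_zero]
  | succ k ih =>
    rw [Finset.prod_range_succ']
    have : ∀ j ∈ Finset.range k, (1 - (2:ℝ)^(k+1) / 2^(j+1)) = 1 - (2:ℝ)^k / 2^j := by
      intro j _
      rw [pow_succ, pow_succ, mul_div_mul_right _ _ (by norm_num)]
    rw [Finset.prod_congr rfl this, ih, Q_succ, Nat.choose_succ_succ' (k+1) 1, Nat.choose_one_right,
      pow_add _ (k+1)]
    have h2 : (2:ℝ)^(k+1) ≠ 0 := by positivity
    field_simp
    ring

lemma prod_high (k m : ℕ) :
    ∏ i ∈ Finset.range m, (1 - (2:ℝ)^k / 2^(k+1+i)) = Q m := by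
  unfold Q
  refine Finset.prod_congr rfl fun i _ => ?_
  rw [lt_zpow_eq, show k+1+i = k + (i+1) by ring, pow_add]
  have h2 : (2:ℝ)^k ≠ 0 := by positivity
  field_simp

lemma prod_erase_eq (n k : ℕ) (hk : k < n) :
    2^k * ∏ j ∈ (Finset.range n).erase k, (1 - (2:ℝ)^k / 2^j)⁻¹
      = (-1:ℝ)^k * ((2:ℝ)^(k.choose 2))⁻¹ / (Q k * Q (n-1-k)) := by
  obtain ⟨m, rfl⟩ : ∃ m, n = k+1+m := ⟨n-(k+1), by omega⟩
  have hset : ∏ j ∈ (Finset.range (k+1+m)).erase k, (1 - (2:ℝ)^k / 2^j)⁻¹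
      = ((∏ j ∈ Finset.range k, (1 - (2:ℝ)^k / 2^j)) *
        ∏ i ∈ Finset.range m, (1 - (2:ℝ)^k / 2^(k+1+i)))⁻¹ := by
    have : ∏ j ∈ (Finset.range (k+1+m)).erase k, (1 - (2:ℝ)^k / 2^j)⁻¹
        = ∏ j ∈ (Finset.range (k+1+m)), if j = k then 1 else (1 - (2:ℝ)^k / 2^j)⁻¹ := by
      rw [← Finset.mul_prod_erase _ _ (Finset.mem_range.2 hk), if_pos rfl, one_mul]
      refine Finset.prod_congr rfl fun j hj => ?_
      rw [if_neg (Finset.ne_of_mem_erase hj)]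
    rw [this, Finset.prod_range_add, Finset.prod_range_succ, if_pos rfl, mul_one, mul_inv,
      ← Finset.prod_inv_distrib, ← Finset.prod_inv_distrib]
    congr 1
    · refine Finset.prod_congr rfl fun j hj => ?_
      rw [if_neg (Finset.mem_range.1 hj).ne]
    · refine Finset.prod_congr rfl fun j hj => ?_
      rw [if_neg (by omega)]
  rw [hset, prod_low, prod_high, show k+1+m-1-k = m by omega, Nat.choose_succ_succ' k 1,
    Nat.choose_one_right, pow_add]
  have h1 : Q k ≠ 0 := by linarith [Q_lower k]
  have h2 : Q m ≠ 0 := by linarith [Q_lower m]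
  have h3 : ((-1:ℝ)^k) * (-1)^k = 1 := by rw [← mul_pow]; simp
  have h4 : ((-1:ℝ)^k) ≠ 0 := by positivity
  field_simp
  rw [pow_two, h3]

lemma partial_frac (n : ℕ) (hn : 0 < n) (s : ℂ) (hs : ∀ j : ℕ, s + 2^j ≠ 0) :
    ∏ j ∈ Finset.range n, (1 + (2:ℂ)^(-(j:ℤ)) * s)⁻¹ =
      ∑ k ∈ Finset.range n,
        (((-1:ℝ)^k * ((2:ℝ)^(k.choose 2))⁻¹ / (Q k * Q (n-1-k)) : ℝ) : ℂ) / (s + 2^k) := by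
  have hinj : Set.InjOn (fun j : ℕ => -(2:ℂ)^j) (Finset.range n) := by
    intro a _ b _ h
    have h : (2:ℂ)^a = 2^b := by simpa using h
    have h' : (2:ℕ)^a = 2^b := by exact_mod_cast h
    exact Nat.pow_right_injective le_rfl h'
  have key := congrArg (Polynomial.eval s) (Lagrange.sum_basis hinj ⟨0, Finset.mem_range.2 hn⟩)
  rw [Polynomial.eval_finsetSum, Polynomial.eval_one] at key
  rw [← one_mul (∏ j ∈ Finset.range n, _)]
  generalize hP : ∏ j ∈ Finset.range n, (1 + (2:ℂ)^(-(j:ℤ)) * s)⁻¹ = P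
  rw [← key, Finset.sum_mul]
  refine Finset.sum_congr rfl fun k hk => ?_
  rw [← hP, ← prod_erase_eq n k (Finset.mem_range.1 hk), ← Finset.mul_prod_erase _ _ hk,
    Lagrange.basis, Polynomial.eval_prod, mul_left_comm, ← Finset.prod_mul_distrib]
  push_cast
  rw [mul_div_right_comm]
  have h2 : ∀ j : ℕ, (2:ℂ)^j ≠ 0 := fun j => pow_ne_zero _ two_ne_zero
  congr 1
  · have := hs k
    have h3 := h2 k
    have : (1 + (2:ℂ)^(-(k:ℤ)) * s) = (s + 2^k) / 2^k := by
      rw [zpow_neg, zpow_natCast]; field_simp; ring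
    rw [this, inv_div]
  · refine Finset.prod_congr rfl fun j hj => ?_
    have h3 := h2 j
    have h4 := hs j
    have : (1 + (2:ℂ)^(-(j:ℤ)) * s) = (s + 2^j) / 2^j := by
      rw [zpow_neg, zpow_natCast]; field_simp; ring
    rw [this, inv_div, one_sub_div h3, inv_div]
    simp only [Lagrange.basisDivisor, Polynomial.eval_mul, Polynomial.eval_C, Polynomial.eval_sub,
      Polynomial.eval_X, sub_neg_eq_add]
    rw [show -(2:ℂ)^k + 2^j = 2^j - 2^k by ring]
    field_simp

lemma coef_bound (k : ℕ) (q : ℝ) (hq : 1/4 ≤ q) :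
    ‖(-1:ℝ)^k * ((2:ℝ)^(k.choose 2))⁻¹ / (Q k * q)‖ ≤ 32 * (1/2)^k := by
  have h1 := Q_lower k
  have h2 : (1/16 : ℝ) ≤ Q k * q := by nlinarith
  rw [norm_div, norm_mul, norm_pow, norm_neg, norm_one, one_pow, one_mul, norm_inv, norm_pow,
    Real.norm_ofNat, Real.norm_of_nonneg (by linarith : 0 ≤ Q k * q)]
  have h3 : ((2:ℝ)^(k.choose 2))⁻¹ ≤ 2 * (1/2)^k := by
    have : (2:ℝ)^k ≤ 2^(k.choose 2 + 1) := by
      apply pow_le_pow_right₀ (by norm_num)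
      induction k with
      | zero => simp
      | succ k _ =>
        rw [Nat.choose_succ_succ' k 1, Nat.choose_one_right]; omega
    rw [pow_succ] at this
    rw [one_div, inv_pow, ← div_eq_mul_inv, inv_eq_one_div, div_le_div_iff₀ (by positivity) (by positivity)]
    linarith
  rw [div_le_iff₀ (by linarith)]
  have : (0:ℝ) < (1/2)^k := by positivity
  nlinarith

/-- For `Re s > −1`, the Laplace transform of `F` is `∏_{j≥0} 1/(1 + 2^{−j}s)`,
and this infinite product converges. -/
theorem laplace_transform_F : ∀ s : ℂ, -1 < s.re →
    Multipliable (fun j : ℕ => (1 + (2:ℂ)^(-(j:ℤ)) * s)⁻¹) ∧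
    ∫ x in Set.Ioi (0:ℝ), Complex.exp (-s * x) * (F x : ℂ) =
      ∏' j : ℕ, (1 + (2:ℂ)^(-(j:ℤ)) * s)⁻¹ := by
  intro s hs
  have hone : ∀ j : ℕ, (1:ℝ) ≤ 2^j := fun j => one_le_pow₀ (by norm_num)
  have hre : ∀ j : ℕ, (s + 2^j).re = s.re + 2^j := by
    intro j
    rw [show (s + 2^j : ℂ) = s + ((2^j : ℝ) : ℂ) by push_cast; rfl, Complex.add_re,
      Complex.ofReal_re]
  have hc : 0 < s.re + 1 := by linarith
  have hnorm : ∀ j : ℕ, s.re + 1 ≤ ‖s + 2^j‖ := by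
    intro j
    have := (Complex.re_le_norm (s + 2^j))
    rw [hre] at this
    linarith [hone j]
  have hne : ∀ j : ℕ, s + 2^j ≠ 0 := fun j h => by
    have := hnorm j
    rw [h, norm_zero] at this
    linarith
  have hgeo : Summable (fun k : ℕ => (1/2 : ℝ)^k) := summable_geometric_two
  -- multipliability
  have hmul : Multipliable (fun j : ℕ => (1 + (2:ℂ)^(-(j:ℤ)) * s)⁻¹) := by
    have heq : (fun j : ℕ => (1 + (2:ℂ)^(-(j:ℤ)) * s)⁻¹) = fun j : ℕ => 1 + (-s / (s + 2^j)) := by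
      funext j
      have h2 : (2:ℂ)^j ≠ 0 := pow_ne_zero _ two_ne_zero
      have := hne j
      have e : (1 + (2:ℂ)^(-(j:ℤ)) * s) = (s + 2^j) / 2^j := by
        rw [zpow_neg, zpow_natCast]; field_simp; ring
      rw [e, inv_div]
      field_simp
      ring
    rw [heq]
    apply multipliable_one_add_of_summable
    set d := min 1 (s.re + 1) with hd
    have hd0 : 0 < d := lt_min one_pos hc
    refine Summable.of_nonneg_of_le (fun _ => norm_nonneg _) (fun j => ?_)
      (hgeo.mul_left (‖s‖ / d))
    have h1 : d * 2^j ≤ ‖s + 2^j‖ := by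
      have h := Complex.re_le_norm (s + 2^j)
      rw [hre] at h
      refine le_trans ?_ h
      have a := hone j
      have b : d ≤ 1 := min_le_left _ _
      have c : d ≤ s.re + 1 := min_le_right _ _
      nlinarith
    rw [norm_div, norm_neg, one_div, inv_pow, ← div_eq_mul_inv, div_div]
    gcongr
  refine ⟨hmul, ?_⟩
  -- limit of partial fractions
  have hlim : Tendsto (fun n : ℕ => ∑' k : ℕ, if k < n then
      (((-1:ℝ)^k * ((2:ℝ)^(k.choose 2))⁻¹ / (Q k * Q (n-1-k)) : ℝ) : ℂ) / (s + 2^k) else 0) atTop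
      (nhds (∑' k : ℕ,
        (((-1:ℝ)^k * ((2:ℝ)^(k.choose 2))⁻¹ / (Q k * Qinf) : ℝ) : ℂ) / (s + 2^k))) := by
    refine tendsto_tsum_of_dominated_convergence
      (bound := fun k => 32 * (1/2)^k / (s.re + 1)) ((hgeo.mul_left 32).div_const _) ?_ ?_
    · intro k
      have h1 : Tendsto (fun n : ℕ => Q (n-1-k)) atTop (nhds Qinf) :=
        Q_tendsto.comp ((tendsto_sub_atTop_nat k).comp (tendsto_sub_atTop_nat 1))
      have hQ : Q k * Qinf ≠ 0 := by
        have := Q_lower k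
        have := Qinf_lower
        positivity
      have h2 : Tendsto (fun n : ℕ =>
          (((-1:ℝ)^k * ((2:ℝ)^(k.choose 2))⁻¹ / (Q k * Q (n-1-k)) : ℝ) : ℂ) / (s + 2^k)) atTop
          (nhds ((((-1:ℝ)^k * ((2:ℝ)^(k.choose 2))⁻¹ / (Q k * Qinf) : ℝ) : ℂ) / (s + 2^k))) := by
        refine Tendsto.div_const ?_ _
        exact (Complex.continuous_ofReal.tendsto _).comp
          (tendsto_const_nhds.div (h1.const_mul _) hQ)
      refine h2.congr' ?_
      filter_upwards [eventually_gt_atTop k] with n hn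
      rw [if_pos hn]
    · refine Eventually.of_forall fun n k => ?_
      split_ifs
      · rw [norm_div, Complex.norm_real]
        exact div_le_div₀ (by positivity) (coef_bound k _ (Q_lower _)) hc (hnorm k)
      · rw [norm_zero]; positivity
  have hprod : ∏' j : ℕ, (1 + (2:ℂ)^(-(j:ℤ)) * s)⁻¹ = ∑' k : ℕ,
        (((-1:ℝ)^k * ((2:ℝ)^(k.choose 2))⁻¹ / (Q k * Qinf) : ℝ) : ℂ) / (s + 2^k) := by
    refine tendsto_nhds_unique hmul.tendsto_prod_tprod_nat (hlim.congr' ?_)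
    filter_upwards [eventually_gt_atTop 0] with n hn
    rw [partial_frac n hn s hne, tsum_eq_sum (s := Finset.range n)]
    · refine Finset.sum_congr rfl fun k hk => ?_
      rw [if_pos (Finset.mem_range.1 hk)]
    · intro k hk
      rw [if_neg (by simpa using hk)]
  rw [hprod]
  -- integral
  set c : ℕ → ℝ := fun k => (-1:ℝ)^k * ((2:ℝ)^(k.choose 2))⁻¹ / (Q k * Qinf) with hcdef
  have hneg : ∀ k : ℕ, (-(s + 2^k)).re < 0 := by
    intro k
    rw [Complex.neg_re, hre]; linarith [hone k]
  have hpt : ∀ x : ℝ, Complex.exp (-s * x) * (F x : ℂ) =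
      ∑' k : ℕ, (c k : ℂ) * Complex.exp (-(s + 2^k) * x) := by
    intro x
    rw [F, Complex.ofReal_tsum, ← tsum_mul_left]
    refine tsum_congr fun k => ?_
    rw [show -(s + 2^k) * (x:ℂ) = -s * x + (((-(2:ℝ)^k * x : ℝ)) : ℂ) by push_cast; ring,
      Complex.exp_add, ← Complex.ofReal_exp]
    simp only [hcdef]
    push_cast
    ring
  have hint : ∀ k : ℕ, MeasureTheory.Integrable
      (fun x : ℝ => (c k : ℂ) * Complex.exp (-(s + 2^k) * x))
      (MeasureTheory.volume.restrict (Set.Ioi 0)) := fun k =>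
    (integrableOn_exp_mul_complex_Ioi (hneg k) 0).const_mul _
  have hnint : ∀ k : ℕ, ∫ x in Set.Ioi (0:ℝ), ‖(c k : ℂ) * Complex.exp (-(s + 2^k) * x)‖
      = ‖c k‖ / (s.re + 2^k) := by
    intro k
    have : ∀ x : ℝ, ‖(c k : ℂ) * Complex.exp (-(s + 2^k) * x)‖
        = ‖c k‖ * Real.exp (-(s.re + 2^k) * x) := by
      intro x
      rw [norm_mul, Complex.norm_real, Complex.norm_exp, Complex.re_mul_ofReal, Complex.neg_re, hre]
    simp_rw [this]
    rw [MeasureTheory.integral_const_mul, integral_exp_mul_Ioi (by linarith [hone k])]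
    rw [mul_zero, Real.exp_zero, neg_div_neg_eq, mul_one_div]
  have hsum : Summable fun k : ℕ =>
      ∫ x in Set.Ioi (0:ℝ), ‖(c k : ℂ) * Complex.exp (-(s + 2^k) * x)‖ := by
    simp_rw [hnint]
    refine Summable.of_nonneg_of_le (fun k => ?_) (fun k => ?_)
      ((hgeo.mul_left 32).div_const (s.re + 1))
    · exact div_nonneg (norm_nonneg _) (by linarith [hone k])
    · exact div_le_div₀ (by positivity) (coef_bound k _ Qinf_lower) hc (by linarith [hone k])
  have hfin := MeasureTheory.hasSum_integral_of_summable_integral_norm hint hsum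
  simp_rw [hpt]
  rw [← hfin.tsum_eq]
  refine tsum_congr fun k => ?_
  rw [MeasureTheory.integral_const_mul, integral_exp_mul_complex_Ioi (hneg k)]
  simp only [Complex.ofReal_zero, mul_zero, Complex.exp_zero, neg_div_neg_eq]
  rw [mul_one_div]
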